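/- Let a_n = ZFib[n] / log_φ(n) for n ≥ 2, where φ is the golden ratio and ZFib[n] is the Zimin type of the length-n prefix of the infinite Fibonacci word. Then every real number α with 1/3 ≤ α ≤ 1/2 is a limit point of the sequence (a_n), i.e., there is a strictly increasing sequence of indices n_i with a_{n_i} → α. -/

import Mathlib

open List Filter

/-- The Zimin pattern `Z_k` as a word over variables `0, 1, ..., k-1`
(`Z_0` is empty, `Z_{k+1} = Z_k · x_{k+1} · Z_k`). -/
def ziminWord : ℕ → List ℕ
  | 0 => []
  | k + 1 => ziminWord k ++ k :: ziminWord k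

/-- `w` is the image of the Zimin pattern `Z_k` under a non-erasing morphism. -/
def IsZiminImage {α : Type*} (k : ℕ) (w : List α) : Prop :=
  ∃ h : ℕ → List α, (∀ i, h i ≠ []) ∧ w = (ziminWord k).flatMap h

/-- The Zimin type of `w`: the maximum `k` such that `w` is an image of `Z_k`
under a non-erasing morphism (0 for the empty word). -/
noncomputable def ziminType {α : Type*} (w : List α) : ℕ :=
  sSup {k | IsZiminImage k w}

/-- The Zimin pattern `Z_k` embeds in `w`: some factor of `w` is an image of `Z_k`. -/
def ziminEmbeds {α : Type*} (k : ℕ) (w : List α) : Prop :=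
  ∃ u : List α, u <:+: w ∧ IsZiminImage k u

/-- Length of the longest border (proper prefix that is also a proper suffix) of `w`. -/
noncomputable def bordLen {α : Type*} (w : List α) : ℕ :=
  sSup {j | w.take j <:+ w ∧ j < w.length}

/-- Length of the longest short border (border of length `< |w|/2`) of `w`. -/
noncomputable def shortBordLen {α : Type*} (w : List α) : ℕ :=
  sSup {j | w.take j <:+ w ∧ 2 * j < w.length}

/-- The longest border of `w`. -/
noncomputable def bord {α : Type*} (w : List α) : List α := w.take (bordLen w)

/-- The longest short border of `w`. -/
noncomputable def shortBord {α : Type*} (w : List α) : List α := w.take (shortBordLen w)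

/-- The Fibonacci words over `Bool` (`a = false`, `b = true`), with
`fibWord 0 = F_0 = a`, `fibWord 1 = F_1 = F_0 F_{-1} = ab`, `F_{n} = F_{n-1} F_{n-2}`. -/
def fibWord : ℕ → List Bool
  | 0 => [false]
  | 1 => [false, true]
  | n + 2 => fibWord (n + 1) ++ fibWord n

/-- The Fibonacci numbers `Φ_n = |F_n|` (`Φ_0 = 1, Φ_1 = 2, Φ_2 = 3, ...`). -/
def Phi (n : ℕ) : ℕ := (fibWord n).length

/-- The infinite Fibonacci word `F_∞` (0-indexed letters). -/
def fibInf (i : ℕ) : Bool := (fibWord (i + 2)).getD i false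

/-- The prefix `F_∞[1..n]` of the infinite Fibonacci word. -/
def fibPrefix (n : ℕ) : List Bool := (List.range n).map fibInf


/-- The golden ratio `φ = (1 + √5)/2`. -/
noncomputable def goldenR : ℝ := (1 + Real.sqrt 5) / 2

/-- The sequence `a_n = ZFib[n] / log_φ n`, where `ZFib[n]` is the Zimin type of
the length-`n` prefix of the infinite Fibonacci word. -/
noncomputable def aseq (n : ℕ) : ℝ :=
  (ziminType (fibPrefix n) : ℝ) / (Real.log n / Real.log goldenR)

lemma ziminWord_lt (k : ℕ) : ∀ x ∈ ziminWord k, x < k := by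
  induction k with
  | zero => simp [ziminWord]
  | succ k ih =>
    intro x hx
    simp only [ziminWord, List.mem_append, List.mem_cons] at hx
    rcases hx with h | h | h
    · have := ih x h; omega
    · omega
    · have := ih x h; omega

lemma flatMap_congr_aux {β : Type*} (l : List ℕ) (h g : ℕ → List β)
    (e : ∀ x ∈ l, h x = g x) : l.flatMap h = l.flatMap g := by
  induction l with
  | nil => rfl
  | cons a l ih =>
    rw [List.flatMap_cons, List.flatMap_cons, e a (by simp), ih (fun x hx => e x (by simp [hx]))]

lemma image_succ {β : Type*} (k : ℕ) (w : List β) :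
    IsZiminImage (k+1) w ↔ ∃ u v, IsZiminImage k u ∧ v ≠ [] ∧ w = u ++ v ++ u := by
  constructor
  · rintro ⟨h, hn, rfl⟩
    refine ⟨(ziminWord k).flatMap h, h k, ⟨h, hn, rfl⟩, hn k, ?_⟩
    simp [ziminWord, List.flatMap_append, List.flatMap_cons]
  · rintro ⟨u, v, ⟨h, hn, rfl⟩, hv, rfl⟩
    refine ⟨Function.update h k v, ?_, ?_⟩
    · intro i
      by_cases e : i = k
      · subst e; simpa using hv
      · simpa [Function.update_of_ne e] using hn i
    · have : (ziminWord k).flatMap (Function.update h k v) = (ziminWord k).flatMap h := by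
        apply flatMap_congr_aux
        intro x hx
        have := ziminWord_lt k x hx
        rw [Function.update_of_ne (by omega)]
      simp only [ziminWord, List.flatMap_append, List.flatMap_cons, this, Function.update_self]
      simp

lemma image_len {β : Type*} (k : ℕ) : ∀ w : List β, IsZiminImage k w → k ≤ w.length := by
  induction k with
  | zero => intros; omega
  | succ k ih =>
    intro w hw
    obtain ⟨u, v, hu, hv, rfl⟩ := (image_succ k w).1 hw
    have := ih u hu
    have := List.length_pos_iff.2 hv
    simp; omega

lemma image_one {w : List Bool} (hw : w ≠ []) : IsZiminImage 1 w :=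
  ⟨fun _ => w, fun _ => hw, by simp [ziminWord]⟩

lemma type_greatest {w : List Bool} (hw : w ≠ []) :
    IsGreatest {k | IsZiminImage k w} (ziminType w) := by
  have hb : BddAbove {k | IsZiminImage k w} := ⟨w.length, fun k hk => image_len k w hk⟩
  exact ⟨Nat.sSup_mem ⟨1, image_one hw⟩ hb, fun k hk => le_csSup hb hk⟩

lemma border_split {β : Type*} {x w : List β} (hp : x <+: w) (hs : x <:+ w)
    (hl : 2 * x.length < w.length) : ∃ v, v ≠ [] ∧ w = x ++ v ++ x := by
  obtain ⟨t, rfl⟩ := hp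
  have ht : x <:+ t := by
    apply List.suffix_of_suffix_length_le hs (List.suffix_append x t)
    simp at hl; omega
  obtain ⟨v, rfl⟩ := ht
  refine ⟨v, ?_, by simp⟩
  rintro rfl
  simp at hl; omega

lemma border_mono {u w : List Bool} (hp : u <+: w) (hs : u <:+ w)
    {k : ℕ} (hk : 1 ≤ k) (hu : IsZiminImage k u) : IsZiminImage k w := by
  obtain ⟨k, rfl⟩ : ∃ k', k = k' + 1 := ⟨k - 1, by omega⟩
  obtain ⟨x, v, hx, hv, rfl⟩ := (image_succ k u).1 hu
  have hvl := List.length_pos_iff.2 hv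
  have hle := hp.length_le
  simp only [List.length_append] at hle
  obtain ⟨v', hv', e⟩ := border_split (x := x) (w := w)
    (List.IsPrefix.trans ⟨v ++ x, by simp⟩ hp) (List.IsSuffix.trans ⟨x ++ v, by simp⟩ hs)
    (by omega)
  exact (image_succ k w).2 ⟨x, v', hx, hv', e⟩

lemma Phi_zero : Phi 0 = 1 := rfl
lemma Phi_one : Phi 1 = 2 := rfl
lemma Phi_add_two (n : ℕ) : Phi (n+2) = Phi (n+1) + Phi n := by
  simp [Phi, fibWord]

lemma Phi_eq_fib (n : ℕ) : Phi n = Nat.fib (n+2) ∧ Phi (n+1) = Nat.fib (n+3) := by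
  induction n with
  | zero => exact ⟨rfl, rfl⟩
  | succ n ih =>
    refine ⟨ih.2, ?_⟩
    rw [Phi_add_two, ih.1, ih.2, Nat.fib_add_two (n := n+2), add_comm]

lemma Phi_gt (n : ℕ) : n < Phi n := by
  rw [(Phi_eq_fib n).1]
  have := Nat.le_fib_add_one (n+2)
  induction n with
  | zero => decide
  | succ n ih =>
    have h1 := ih (Nat.le_fib_add_one _)
    have h2 : Nat.fib (n+2) < Nat.fib (n+2+1) := Nat.fib_lt_fib_succ (by omega)
    have h3 : n + 1 + 2 = n + 2 + 1 := by omega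
    rw [h3]
    omega

lemma Phi_lt_succ (n : ℕ) : Phi n < Phi (n+1) := by
  rw [(Phi_eq_fib n).1, (Phi_eq_fib n).2]
  exact Nat.fib_lt_fib_succ (by omega)

lemma Phi_strictMono : StrictMono Phi := strictMono_nat_of_lt_succ Phi_lt_succ

lemma fibWord_prefix_succ (n : ℕ) : fibWord n <+: fibWord (n+1) := by
  cases n with
  | zero => exact ⟨[true], rfl⟩
  | succ n => exact ⟨fibWord n, rfl⟩

lemma fibWord_prefix {m n : ℕ} (h : m ≤ n) : fibWord m <+: fibWord n := by
  induction n, h using Nat.le_induction with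
  | base => exact List.prefix_rfl
  | succ n _ ih => exact ih.trans (fibWord_prefix_succ n)

lemma getD_prefix {a b : List Bool} (h : a <+: b) {i : ℕ} (hi : i < a.length) :
    a.getD i false = b.getD i false := by
  obtain ⟨t, rfl⟩ := h
  rw [List.getD_append _ _ _ _ hi]

lemma fibInf_eq {k i : ℕ} (hi : i < Phi k) : fibInf i = (fibWord k).getD i false := by
  unfold fibInf
  have h2 : i < Phi (i+2) := by have := Phi_gt (i+2); omega
  rcases le_total k (i+2) with h | h
  · exact (getD_prefix (fibWord_prefix h) hi).symm
  · exact getD_prefix (fibWord_prefix h) h2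

lemma fibInf_shift {k i : ℕ} (hi : i < Phi k) : fibInf (Phi (k+1) + i) = fibInf i := by
  rw [fibInf_eq hi, fibInf_eq (k := k+2) (by rw [Phi_add_two]; omega)]
  show (fibWord (k+1) ++ fibWord k).getD _ _ = _
  rw [List.getD_append_right _ _ _ _ (by unfold Phi; omega)]
  congr 1
  unfold Phi; omega

lemma fib_BC (k : ℕ) : (∀ i, i + 2 < Phi (k+1) → fibInf (Phi k + i) = fibInf i) ∧
    (∀ i, i + 2 = Phi (k+1) → fibInf (Phi k + i) ≠ fibInf i) := by
  induction k with
  | zero =>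
    constructor
    · intro i hi; rw [zero_add, Phi_one] at hi; omega
    · intro i hi; rw [zero_add, Phi_one] at hi
      obtain rfl : i = 0 := by omega
      decide
  | succ k ih =>
    have key : ∀ i, i + 2 ≤ Phi (k+1) →
        fibInf (Phi (k+1) + (Phi k + i)) = fibInf i := by
      intro i hi
      rw [← add_assoc, ← Phi_add_two]
      exact fibInf_shift (by omega)
    have e := Phi_add_two k
    have e1 : k + 1 + 1 = k + 2 := rfl
    rw [e1]
    constructor
    · intro i hi
      by_cases h : i < Phi k
      · exact fibInf_shift h
      · obtain ⟨i', rfl⟩ := Nat.exists_eq_add_of_le (not_lt.1 h)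
        rw [key i' (by omega), ih.1 i' (by omega)]
    · intro i hi
      have : 2 ≤ Phi (k+1) := by have := Phi_gt (k+1); omega
      obtain ⟨i', rfl⟩ := Nat.exists_eq_add_of_le (show Phi k ≤ i by omega)
      rw [key i' (by omega)]
      exact (ih.2 i' (by omega)).symm

/-- no overlapping occurrence -/
lemma fib_A (j : ℕ) : ∀ p, 0 < p → p < Phi j →
    ∃ i, i + 2 ≤ Phi j ∧ fibInf (p + i) ≠ fibInf i := by
  induction j using Nat.strong_induction_on with
  | _ j ih =>
    intro p hp0 hpj
    match j, ih with
    | 0, _ => rw [Phi_zero] at hpj; omega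
    | 1, _ =>
      rw [Phi_one] at hpj
      obtain rfl : p = 1 := by omega
      exact ⟨0, by rw [Phi_one], by decide⟩
    | j+2, ih =>
      have e := Phi_add_two j
      have hlt := Phi_lt_succ j
      have h2 : 2 ≤ Phi (j+1) := by have := Phi_gt (j+1); omega
      rcases lt_trichotomy p (Phi (j+1)) with h | h | h
      · obtain ⟨i, hi, hne⟩ := ih (j+1) (by omega) p hp0 h
        exact ⟨i, by omega, hne⟩
      · subst h
        exact ⟨Phi (j+2) - 2, by omega, (fib_BC (j+1)).2 _ (by
          show _ = Phi (j+2)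
          omega)⟩
      · obtain ⟨r, rfl⟩ := Nat.exists_eq_add_of_lt h
        obtain ⟨i, hi, hne⟩ := ih j (by omega) (r+1) (by omega) (by omega)
        refine ⟨i, by omega, ?_⟩
        have := (fib_BC (j+1)).1 (r + 1 + i) (by
          show _ < Phi (j+2)
          omega)
        rw [← this] at hne
        convert hne using 2
        omega

/-- no period of the prefix strictly between half its length and `Phi j`. -/
lemma no_period (j m p : ℕ) (hm : Phi (j+1) ≤ m) (hp : p < Phi (j+4))
    (h2 : Phi (j+4) + m < 2 * p) :
    ∃ i, p + i < Phi (j+4) + m ∧ fibInf (p + i) ≠ fibInf i := by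
  have e4 : Phi (j+4) = Phi (j+3) + Phi (j+2) := Phi_add_two (j+2)
  have e3 : Phi (j+3) = Phi (j+2) + Phi (j+1) := Phi_add_two (j+1)
  have e2 : Phi (j+2) = Phi (j+1) + Phi j := Phi_add_two j
  obtain ⟨r, rfl⟩ := Nat.exists_eq_add_of_lt (show Phi (j+3) < p by omega)
  have hlt := Phi_lt_succ j
  have h0 := Phi_gt j
  have key : ∀ i, r + 1 + i + 2 < Phi (j+4) →
      fibInf (Phi (j+3) + r + 1 + i) = fibInf (r + 1 + i) := by
    intro i hi
    have := (fib_BC (j+3)).1 (r+1+i) hi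
    rw [← this]; congr 1; omega
  by_cases hr : r + 1 ≤ m + 1
  · obtain ⟨i, hi, hne⟩ := fib_A (j+2) (r+1) (by omega) (by omega)
    exact ⟨i, by omega, by rw [key i (by omega)]; exact hne⟩
  · obtain ⟨s, rfl⟩ := Nat.exists_eq_add_of_lt (show Phi (j+1) < r by omega)
    obtain ⟨i, hi, hne⟩ := fib_A j (s+2) (by omega) (by omega)
    refine ⟨i, by omega, ?_⟩
    rw [key i (by omega)]
    have := (fib_BC (j+1)).1 (s+2+i) (by
      show _ < Phi (j+2)
      omega)
    rw [← this] at hne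
    convert hne using 2
    omega

lemma fibPrefix_length (n : ℕ) : (fibPrefix n).length = n := by simp [fibPrefix]

lemma fibPrefix_add (p q : ℕ) :
    fibPrefix (p + q) = fibPrefix p ++ (List.range q).map (fun i => fibInf (p + i)) := by
  simp [fibPrefix, List.range_add, Function.comp_def]

lemma fibPrefix_prefix {a b : ℕ} (h : a ≤ b) : fibPrefix a <+: fibPrefix b := by
  obtain ⟨c, rfl⟩ := Nat.exists_eq_add_of_le h
  rw [fibPrefix_add]
  exact List.prefix_append _ _

lemma fibPrefix_suffix (p q : ℕ) :
    fibPrefix q <:+ fibPrefix (p + q) ↔ ∀ i < q, fibInf (p + i) = fibInf i := by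
  rw [fibPrefix_add]
  constructor
  · intro h
    have h1 : fibPrefix q <:+ (List.range q).map (fun i => fibInf (p + i)) :=
      List.suffix_of_suffix_length_le h (List.suffix_append _ _) (by simp [fibPrefix])
    have h2 := h1.eq_of_length (by simp [fibPrefix])
    unfold fibPrefix at h2
    intro i hi
    exact ((List.map_inj_left.1 h2) i (List.mem_range.2 hi)).symm
  · intro h
    have : fibPrefix q = (List.range q).map (fun i => fibInf (p + i)) := by
      unfold fibPrefix
      apply List.map_congr_left
      intro i hi
      exact (h i (List.mem_range.1 hi)).symm
    rw [this]
    exact List.suffix_append _ _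

lemma type_step (j m : ℕ) (hm : Phi (j+1) ≤ m) (hm' : m < Phi (j+4)) :
    ziminType (fibPrefix (Phi (j+4) + m)) = ziminType (fibPrefix m) + 1 := by
  have hne : ∀ n, 0 < n → fibPrefix n ≠ [] := by
    intro n hn h
    have := fibPrefix_length n
    rw [h] at this; simp at this; omega
  have hm0 : 0 < m := by have := Phi_gt (j+1); omega
  have gm := type_greatest (hne m hm0)
  have gn := type_greatest (hne (Phi (j+4) + m) (by omega))
  have hsuf : fibPrefix m <:+ fibPrefix (Phi (j+4) + m) := by
    rw [fibPrefix_suffix]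
    intro i hi
    apply (fib_BC (j+4)).1
    have e : Phi (j+5) = Phi (j+4) + Phi (j+3) := Phi_add_two (j+3)
    have := Phi_gt (j+3)
    show _ < Phi (j+5)
    omega
  apply le_antisymm
  · obtain ⟨k, hk⟩ : ∃ k, k = ziminType (fibPrefix (Phi (j+4) + m)) := ⟨_, rfl⟩
    have hmem := gn.1
    rw [← hk] at hmem ⊢
    by_cases hk1 : k ≤ 1
    · omega
    obtain ⟨k, rfl⟩ : ∃ k', k = k' + 1 := ⟨k - 1, by omega⟩
    obtain ⟨u, v, hu, hv, huv⟩ := (image_succ k _).1 hmem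
    have hlen := congrArg List.length huv
    have hvl := List.length_pos_iff.2 hv
    rw [fibPrefix_length] at hlen
    simp only [List.length_append] at hlen
    have hup : u <+: fibPrefix (Phi (j+4) + m) := ⟨v ++ u, by rw [huv]; simp⟩
    have hus : u <:+ fibPrefix (Phi (j+4) + m) := ⟨u ++ v, by rw [huv]⟩
    obtain ⟨q, hq⟩ : ∃ q, q = u.length := ⟨_, rfl⟩
    have hueq : u = fibPrefix q := by
      have h1 : u <+: fibPrefix q := List.prefix_of_prefix_length_le hup
        (fibPrefix_prefix (by omega)) (by rw [fibPrefix_length, hq])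
      exact h1.eq_of_length (by rw [fibPrefix_length, hq])
    obtain ⟨p, hp⟩ := Nat.exists_eq_add_of_le' (show q ≤ Phi (j+4) + m by omega)
    have hqm : q ≤ m := by
      by_contra hcon
      obtain ⟨i, hi, hne⟩ := no_period j m p hm (by omega) (by omega)
      rw [hueq, hp, fibPrefix_suffix] at hus
      exact hne (hus i (by omega))
    have := gm.2 (show IsZiminImage k (fibPrefix m) from border_mono (u := u)
      (by rw [hueq]; exact fibPrefix_prefix hqm)
      (List.suffix_of_suffix_length_le hus hsuf (by rw [fibPrefix_length]; omega))
      (by omega) hu)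
    omega
  · apply gn.2
    obtain ⟨v, hv, e⟩ := border_split (fibPrefix_prefix (show m ≤ Phi (j+4) + m by omega)) hsuf
      (by simp only [fibPrefix_length]; omega)
    exact (image_succ _ _).2 ⟨_, v, gm.1, hv, e⟩

lemma step' (t m d : ℕ) (hd : d = 2 ∨ d = 3) (h1 : Phi (t+2) ≤ m) (h2 : m < Phi (t+3)) :
    ∃ n, Phi (t+2+d) ≤ n ∧ n < Phi (t+3+d) ∧
      ziminType (fibPrefix n) = ziminType (fibPrefix m) + 1 := by
  rcases hd with rfl | rfl
  · have a1 := Phi_lt_succ (t+1)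
    have a2 := Phi_lt_succ (t+3)
    have e : Phi (t+5) = Phi (t+4) + Phi (t+3) := Phi_add_two (t+3)
    refine ⟨Phi (t+4) + m, by show Phi (t+4) ≤ _; omega, ?_, type_step t m (le_trans a1.le h1) (lt_trans h2 a2)⟩
    show _ < Phi (t+5)
    omega
  · have a2 := Phi_lt_succ (t+3)
    have a3 := Phi_lt_succ (t+4)
    have e : Phi (t+6) = Phi (t+5) + Phi (t+4) := Phi_add_two (t+4)
    have a2' : Phi (t+3) < Phi (t+4) := a2
    have a3' : Phi (t+4) < Phi (t+5) := a3
    refine ⟨Phi (t+5) + m, by show Phi (t+5) ≤ _; omega, ?_, type_step (t+1) m h1 (by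
      show _ < Phi (t+5)
      omega)⟩
    show _ < Phi (t+6)
    omega

lemma family (k l : ℕ) : ∃ n, Phi (3*k+2*l+2) ≤ n ∧ n < Phi (3*k+2*l+3) ∧
    ziminType (fibPrefix n) = ziminType (fibPrefix (Phi 2)) + k + l := by
  induction k with
  | zero =>
    induction l with
    | zero => exact ⟨Phi 2, le_rfl, Phi_lt_succ 2, rfl⟩
    | succ l ih =>
      obtain ⟨m, h1, h2, h3⟩ := ih
      obtain ⟨n, g1, g2, g3⟩ := step' _ m 2 (Or.inl rfl) h1 h2
      exact ⟨n, g1, g2, by rw [g3, h3]; omega⟩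
  | succ k ih =>
    obtain ⟨m, h1, h2, h3⟩ := ih
    obtain ⟨n, g1, g2, g3⟩ := step' _ m 3 (Or.inr rfl) h1 h2
    refine ⟨n, ?_, ?_, by rw [g3, h3]; omega⟩
    · convert g1 using 2; omega
    · convert g2 using 2; omega

lemma goldenR_sq : goldenR ^ 2 = goldenR + 1 := by
  unfold goldenR
  have := Real.sq_sqrt (show (0:ℝ) ≤ 5 by norm_num)
  nlinarith

lemma goldenR_gt : 1 < goldenR ∧ goldenR < 2 := by
  unfold goldenR
  have h1 : 1 < Real.sqrt 5 := by
    rw [Real.lt_sqrt (by norm_num)]; norm_num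
  have h2 : Real.sqrt 5 < 3 := by
    rw [Real.sqrt_lt' (by norm_num)]; norm_num
  constructor <;> linarith

lemma Phi_bounds (t : ℕ) : (goldenR ^ t ≤ Phi t ∧ (Phi t : ℝ) ≤ goldenR ^ (t+2)) ∧
    (goldenR ^ (t+1) ≤ Phi (t+1) ∧ (Phi (t+1) : ℝ) ≤ goldenR ^ (t+3)) := by
  have hs := goldenR_sq
  obtain ⟨g1, g2⟩ := goldenR_gt
  induction t with
  | zero =>
    simp only [Phi_zero, zero_add, Phi_one, pow_zero, pow_one, Nat.cast_one, Nat.cast_ofNat, hs]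
    have h3 : goldenR ^ 3 = 2 * goldenR + 1 := by
      rw [pow_succ, hs, add_mul, ← sq, hs]; ring
    rw [h3]
    refine ⟨⟨le_rfl, ?_⟩, ?_, ?_⟩ <;> linarith
  | succ t ih =>
    refine ⟨ih.2, ?_⟩
    have e : (Phi (t+1+1) : ℝ) = Phi (t+1) + Phi t := by
      exact_mod_cast Phi_add_two t
    have e1 : goldenR ^ (t+1+1) = goldenR ^ (t+1) + goldenR ^ t := by
      rw [show t+1+1 = t + 2 from rfl, pow_add, hs]; ring
    have e2 : goldenR ^ (t+1+3) = goldenR ^ (t+3) + goldenR ^ (t+2) := by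
      rw [show t+1+3 = t + 2 + 2 from rfl, pow_add _ (t+2), hs]; ring
    rw [e, e1, e2]
    constructor <;> linarith [ih.1.1, ih.1.2, ih.2.1, ih.2.2]

lemma log_bounds {t n : ℕ} (h1 : Phi t ≤ n) (h2 : n < Phi (t+1)) :
    (t : ℝ) ≤ Real.log n / Real.log goldenR ∧ Real.log n / Real.log goldenR ≤ t + 3 := by
  obtain ⟨g1, g2⟩ := goldenR_gt
  have hl : 0 < Real.log goldenR := Real.log_pos g1
  have b := Phi_bounds t
  have hn1 : goldenR ^ t ≤ (n:ℝ) := b.1.1.trans (by exact_mod_cast h1)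
  have hn2 : (n:ℝ) ≤ goldenR ^ (t+3) := le_trans (by exact_mod_cast h2.le) b.2.2
  have hpos : 0 < goldenR ^ t := by positivity
  rw [le_div_iff₀ hl, div_le_iff₀ hl]
  constructor
  · rw [← Real.log_pow]; exact Real.log_le_log hpos hn1
  · have := Real.log_le_log (lt_of_lt_of_le hpos hn1) hn2
    rw [Real.log_pow] at this
    push_cast at this
    exact this

/-- Corollary 1 (part): every `α ∈ [1/3, 1/2]` is a limit point of the sequence
`a_n = ZFib[n] / log_φ n`. -/
theorem limitPoints_aseq (α : ℝ) (h1 : 1 / 3 ≤ α) (h2 : α ≤ 1 / 2) :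
    ∃ idx : ℕ → ℕ, StrictMono idx ∧
      Filter.Tendsto (fun i => aseq (idx i)) Filter.atTop (nhds α) := by
  have hα : 0 < α := by linarith
  obtain ⟨β, hβ⟩ : ∃ β, β = 1 / α - 2 := ⟨_, rfl⟩
  have hβ0 : 0 ≤ β := by
    rw [hβ, sub_nonneg, le_div_iff₀ hα]; linarith
  have hβ1 : β ≤ 1 := by
    rw [hβ, sub_le_iff_le_add, div_le_iff₀ hα]; linarith
  obtain ⟨κ, hκ⟩ : ∃ κ : ℕ → ℕ, κ = fun N : ℕ => ⌊β * (N:ℝ)⌋₊ := ⟨_, rfl⟩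
  have hκle : ∀ N, κ N ≤ N := by
    intro N
    rw [hκ]
    apply Nat.floor_le_of_le
    nlinarith [Nat.cast_nonneg (α := ℝ) N]
  have hκm : Monotone κ := by
    intro a b hab
    rw [hκ]
    apply Nat.floor_mono
    have : (a:ℝ) ≤ b := by exact_mod_cast hab
    nlinarith
  choose idx hi1 hi2 hi3 using fun N => family (κ N) (N - κ N)
  have et : ∀ N, 3 * κ N + 2 * (N - κ N) + 2 = 2 * N + κ N + 2 := by
    intro N; have := hκle N; omega
  refine ⟨idx, ?_, ?_⟩
  · apply strictMono_nat_of_lt_succ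
    intro N
    refine lt_of_lt_of_le (hi2 N) (le_trans (Phi_strictMono.monotone ?_) (hi1 (N+1)))
    have := et N
    have := et (N+1)
    have := hκm (Nat.le_succ N)
    simp only [Nat.succ_eq_add_one] at this
    omega
  · obtain ⟨c, hc⟩ : ∃ c : ℕ, c = ziminType (fibPrefix (Phi 2)) := ⟨_, rfl⟩
    have hz : ∀ N, ziminType (fibPrefix (idx N)) = c + N := by
      intro N; have := hi3 N; have := hκle N; omega
    obtain ⟨L, hL⟩ : ∃ L : ℕ → ℝ, L = fun N => Real.log (idx N) / Real.log goldenR := ⟨_, rfl⟩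
    have hLb : ∀ N : ℕ, (2 + β) * N + 1 ≤ L N ∧ L N ≤ (2 + β) * N + 5 := by
      intro N
      have hb := log_bounds (hi1 N) (hi2 N)
      rw [et N] at hb
      have k1 : (κ N : ℝ) ≤ β * N := by
        rw [hκ]; exact Nat.floor_le (by positivity)
      have k2 : β * N < κ N + 1 := by
        rw [hκ]; exact Nat.lt_floor_add_one _
      rw [hL]
      push_cast at hb
      constructor <;> linarith [hb.1, hb.2]
    have hαβ : 2 + β = 1 / α := by rw [hβ]; ring
    have hinv : Tendsto (fun N : ℕ => 1 / (N:ℝ)) atTop (nhds 0) :=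
      tendsto_one_div_atTop_nhds_zero_nat
    have hLN : Tendsto (fun N : ℕ => L N / N) atTop (nhds (2 + β)) := by
      have hlow : Tendsto (fun N : ℕ => (2 + β) + 1 * (1 / (N:ℝ))) atTop (nhds (2 + β)) := by
        simpa using (hinv.const_mul 1).const_add (2 + β)
      have hup : Tendsto (fun N : ℕ => (2 + β) + 5 * (1 / (N:ℝ))) atTop (nhds (2 + β)) := by
        simpa using (hinv.const_mul 5).const_add (2 + β)
      refine tendsto_of_tendsto_of_tendsto_of_le_of_le' hlow hup ?_ ?_
      · filter_upwards [eventually_gt_atTop 0] with N hN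
        have : (0:ℝ) < N := by exact_mod_cast hN
        rw [le_div_iff₀ this]
        have := (hLb N).1
        field_simp
        linarith
      · filter_upwards [eventually_gt_atTop 0] with N hN
        have : (0:ℝ) < N := by exact_mod_cast hN
        rw [div_le_iff₀ this]
        have := (hLb N).2
        field_simp
        linarith
    have hnum : Tendsto (fun N : ℕ => 1 + (c:ℝ) * (1 / (N:ℝ))) atTop (nhds 1) := by
      simpa using (hinv.const_mul (c:ℝ)).const_add 1
    have hq := hnum.div hLN (by rw [hαβ]; positivity)
    rw [hαβ, one_div_one_div] at hq
    refine hq.congr' ?_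
    filter_upwards [eventually_gt_atTop 0] with N hN
    have hN' : (0:ℝ) < N := by exact_mod_cast hN
    have hLp : 0 < L N := by
      have := (hLb N).1
      have : 0 ≤ (2 + β) * (N:ℝ) := by positivity
      linarith
    have : aseq (idx N) = ((c + N : ℕ) : ℝ) / L N := by
      unfold aseq; rw [hz, hL]
    rw [this]
    push_cast
    simp only [Pi.div_apply]
    field_simp
    ring
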